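/- For every n ≥ 1 and 0 ≤ k ≤ n, the operator P_k := (1/[n choose k])·E^{(k)}∘F^{(k)} on V^{⊗n} maps the weight space W_k into itself, and its restriction to W_k is idempotent: P_k∘P_k = P_k as operators on W_k. -/

import Mathlib

set_option maxHeartbeats 1000000
set_option synthInstance.maxHeartbeats 400000

/-! Common setup: `Fq = ℚ(q)`, the tensor power `V^{⊗n}` of `V = Fq²` realized as
functions on the set of `{0,1}`-sequences (its standard basis), the Temperley-Lieb
and braid operators `U_i, t_i, t_i'`, the quantum `sl₂` operators `E, F, K^{⊗n}`,
weight spaces, quantum integers and the Jones-Wenzl operators. -/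

noncomputable section

/-- The field `ℚ(q)` of rational functions. -/
abbrev Fq := RatFunc ℚ

/-- The variable `q`. -/
def q : Fq := RatFunc.X

/-- `V^{⊗n}` for `V = Fq²`: functions on the index set of the standard basis
`v_{i₁} ⊗ ⋯ ⊗ v_{iₙ}`, `i_r ∈ {0,1}` (here `false ↔ v₀`, `true ↔ v₁`). -/
abbrev Tens (n : ℕ) := (Fin n → Bool) → Fq

/-- Coefficients of `Ũ` on `V ⊗ V`: `uCoef a b c d` is the coefficient of
`v_c ⊗ v_d` in `Ũ(v_a ⊗ v_b)`. -/
def uCoef : Bool → Bool → Bool → Bool → Fq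
  | false, true, true, false => 1
  | false, true, false, true => -q
  | true, false, true, false => -q⁻¹
  | true, false, false, true => 1
  | _, _, _, _ => 0

/-- Coefficients of `t̃` on `V ⊗ V`. -/
def tCoef : Bool → Bool → Bool → Bool → Fq
  | false, false, false, false => 1
  | true, true, true, true => 1
  | false, true, true, false => q
  | false, true, false, true => 1 - q ^ 2
  | true, false, false, true => q
  | _, _, _, _ => 0

/-- Coefficients of `t̃′` on `V ⊗ V`. -/
def tpCoef : Bool → Bool → Bool → Bool → Fq
  | false, false, false, false => 1
  | true, true, true, true => 1
  | false, true, true, false => q⁻¹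
  | true, false, true, false => 1 - (q ^ 2)⁻¹
  | true, false, false, true => q⁻¹
  | _, _, _, _ => 0

/-- Matrix of the operator `id^{⊗(i-1)} ⊗ T ⊗ id^{⊗(n-i-1)}` acting on the
(1-based) tensor factors `i, i+1` of `V^{⊗n}`, where `T` has coefficient matrix `m`:
the `(t, s)` entry is the coefficient of the basis vector indexed by `t` in the image
of the basis vector indexed by `s`. -/
def locMat (n : ℕ) (m : Bool → Bool → Bool → Bool → Fq) (i : ℕ) :
    Matrix (Fin n → Bool) (Fin n → Bool) Fq := fun t s =>
  if h : 1 ≤ i ∧ i < n then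
    let i0 : Fin n := ⟨i - 1, by omega⟩
    let i1 : Fin n := ⟨i, by omega⟩
    if s = Function.update (Function.update t i0 (s i0)) i1 (s i1) then
      m (s i0) (s i1) (t i0) (t i1)
    else 0
  else 0

/-- The Temperley-Lieb operator `U_i = id^{⊗(i-1)} ⊗ Ũ ⊗ id^{⊗(n-i-1)}` (1-based `i`). -/
def Uop (n i : ℕ) : Module.End Fq (Tens n) := (locMat n uCoef i).mulVecLin

/-- The braid operator `t_i = id^{⊗(i-1)} ⊗ t̃ ⊗ id^{⊗(n-i-1)}` (1-based `i`). -/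
def tOp (n i : ℕ) : Module.End Fq (Tens n) := (locMat n tCoef i).mulVecLin

/-- The inverse braid operator `t_i′ = id^{⊗(i-1)} ⊗ t̃′ ⊗ id^{⊗(n-i-1)}` (1-based `i`). -/
def tpOp (n i : ℕ) : Module.End Fq (Tens n) := (locMat n tpCoef i).mulVecLin

/-- Number of indices `r` with `i_r = 1` in the basis index `s`. -/
def countOnes {n : ℕ} (s : Fin n → Bool) : ℕ := (Finset.univ.filter fun r => s r = true).card

/-- The weight space `W_k = V₁^{⊗n}[-n+2k]`: the span of the standard basis vectors
with exactly `k` of the `i_r` equal to `1`. -/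
def weightSpace (n k : ℕ) : Submodule Fq (Tens n) :=
  Submodule.span Fq {ψ : Tens n | ∃ s : Fin n → Bool, countOnes s = k ∧ ψ = Pi.single s 1}

/-- Eigenvalue of `K` on `v_b`. -/
def kval (b : Bool) : Fq := if b then q else q⁻¹

/-- Matrix of `E = Σ_j K^{⊗(j-1)} ⊗ e ⊗ id^{⊗(n-j)}` on `V^{⊗n}`. -/
def Emat (n : ℕ) : Matrix (Fin n → Bool) (Fin n → Bool) Fq := fun t s =>
  ∑ j : Fin n,
    if s j = false ∧ t = Function.update s j true then
      ∏ r ∈ Finset.univ.filter fun r => r < j, kval (s r)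
    else 0

/-- Matrix of `F = Σ_j id^{⊗(j-1)} ⊗ f ⊗ (K⁻¹)^{⊗(n-j)}` on `V^{⊗n}`. -/
def Fmat (n : ℕ) : Matrix (Fin n → Bool) (Fin n → Bool) Fq := fun t s =>
  ∑ j : Fin n,
    if s j = true ∧ t = Function.update s j false then
      ∏ r ∈ Finset.univ.filter fun r => j < r, (kval (s r))⁻¹
    else 0

/-- The operator `E` on `V^{⊗n}`. -/
def Eop (n : ℕ) : Module.End Fq (Tens n) := (Emat n).mulVecLin

/-- The operator `F` on `V^{⊗n}`. -/
def Fop (n : ℕ) : Module.End Fq (Tens n) := (Fmat n).mulVecLin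

/-- The operator `𝐊 = K^{⊗n}` on `V^{⊗n}`. -/
def Kop (n : ℕ) : Module.End Fq (Tens n) :=
  (Matrix.diagonal fun s : Fin n → Bool => ∏ r, kval (s r)).mulVecLin

/-- The operator `𝐊⁻¹ = (K⁻¹)^{⊗n}` on `V^{⊗n}`. -/
def Kinvop (n : ℕ) : Module.End Fq (Tens n) :=
  (Matrix.diagonal fun s : Fin n → Bool => (∏ r, kval (s r))⁻¹).mulVecLin

/-- The quantum integer `[m] = (q^m - q^{-m})/(q - q⁻¹)`. -/
def qint (m : ℕ) : Fq := (q ^ m - q⁻¹ ^ m) / (q - q⁻¹)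

/-- The quantum factorial `[m]! = [1][2]⋯[m]`. -/
def qfact (m : ℕ) : Fq := ∏ i ∈ Finset.range m, qint (i + 1)

/-- The quantum binomial coefficient `[n choose k] = [n]!/([k]!·[n-k]!)`. -/
def qbinom (n k : ℕ) : Fq := qfact n / (qfact k * qfact (n - k))

/-- The divided power `E^{(k)} = E^k/[k]!`. -/
def Ediv (n k : ℕ) : Module.End Fq (Tens n) := (qfact k)⁻¹ • (Eop n) ^ k

/-- The divided power `F^{(k)} = F^k/[k]!`. -/
def Fdiv (n k : ℕ) : Module.End Fq (Tens n) := (qfact k)⁻¹ • (Fop n) ^ k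

/-- The operator `P_k = (1/[n choose k])·E^{(k)} ∘ F^{(k)}` (the Jones-Wenzl projector
on the weight space `W_k`). -/
def JW (n k : ℕ) : Module.End Fq (Tens n) := (qbinom n k)⁻¹ • (Ediv n k ∘ₗ Fdiv n k)

/-- The vectors `l_r` (1-based): `l_r = v₀^{⊗(r-1)} ⊗ (v₁⊗v₀ - q·v₀⊗v₁) ⊗ v₀^{⊗(n-r-1)}`
for `r ≠ n`, and `l_n = v₀^{⊗(n-1)} ⊗ v₁`. -/
def ell (n j : ℕ) : Tens n :=
  if j = n then Pi.single (fun r => decide (r.val = n - 1)) 1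
  else (Pi.single (fun r => decide (r.val = j - 1)) 1 : Tens n)
      - q • (Pi.single (fun r => decide (r.val = j)) 1 : Tens n)

/-- The span of `l_1, …, l_n`. -/
def ellSpan (n : ℕ) : Submodule Fq (Tens n) :=
  Submodule.span Fq {v : Tens n | ∃ j, 1 ≤ j ∧ j ≤ n ∧ v = ell n j}

lemma sum_prod_lt_eq_geom_sum {R : Type*} [CommSemiring R] (x : R) {n : ℕ} (s : Fin n → Bool) :
    (∑ j, if s j = true then
      ∏ r ∈ Finset.univ.filter (fun r => r < j), (if s r = true then x else 1) else 0) =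
    ∑ i ∈ Finset.range (countOnes s), x ^ i := by
  induction n with
  | zero => simp [countOnes]
  | succ n ih =>
    have hfil (j : Fin n) : (∏ r ∈ Finset.univ.filter (fun r => r < j.succ),
        (if s r = true then x else 1)) = (if s 0 = true then x else 1) *
        ∏ r ∈ Finset.univ.filter (fun r => r < j), (if s r.succ = true then x else 1) := by
      rw [Finset.prod_filter, Fin.prod_univ_succ, Finset.prod_filter]
      simp
    have hcount : countOnes s = (if s 0 = true then 1 else 0) + countOnes (fun j => s j.succ) := by
      simp only [countOnes, Finset.card_filter]
      rw [Fin.sum_univ_succ]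
    have ih' := ih (fun j => s j.succ)
    rw [Fin.sum_univ_succ, hcount]
    have hterm (j : Fin n) (a b : R) : (if s j.succ = true then a * b else 0) =
        a * if s j.succ = true then b else 0 := by split_ifs <;> simp
    simp only [hfil, hterm, ← Finset.mul_sum, ih']
    by_cases h : s 0 = true
    · rw [if_pos h, if_pos h, if_pos h, add_comm 1 (countOnes _), geom_sum_succ, add_comm]
      simp
    · simp [h]

lemma sum_prod_gt_eq_geom_sum {R : Type*} [CommSemiring R] (x : R) {n : ℕ} (s : Fin n → Bool) :
    (∑ j, if s j = true then
      ∏ r ∈ Finset.univ.filter (fun r => j < r), (if s r = true then x else 1) else 0) =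
    ∑ i ∈ Finset.range (countOnes s), x ^ i := by
  have hcount : countOnes (fun j => s j.rev) = countOnes s := by
    simp only [countOnes, Finset.card_filter]
    exact Equiv.sum_comp Fin.revPerm fun j => if s j = true then 1 else 0
  rw [← hcount, ← sum_prod_lt_eq_geom_sum, ← Equiv.sum_comp Fin.revPerm]
  refine Finset.sum_congr rfl fun j _ => ?_
  simp only [Fin.revPerm_apply, Finset.prod_filter]
  rw [← Equiv.prod_comp Fin.revPerm]
  simp only [Fin.revPerm_apply, Fin.rev_lt_rev]

lemma q_ne_zero : q ≠ 0 := RatFunc.X_ne_zero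

lemma q_pow_ne_one {m : ℕ} (hm : m ≠ 0) : q ^ m ≠ 1 := by
  intro h
  have h' : (Polynomial.X : Polynomial ℚ) ^ m = 1 := by
    apply RatFunc.algebraMap_injective ℚ
    simpa [q] using h
  have := congrArg Polynomial.natDegree h'
  simp at this
  exact hm this

lemma q_sub_inv_ne_zero : q - q⁻¹ ≠ 0 := by
  intro h
  apply q_pow_ne_one two_ne_zero
  have := q_ne_zero
  field_simp at h
  linear_combination h

lemma qint_ne_zero {m : ℕ} (hm : m ≠ 0) : qint m ≠ 0 := by
  refine div_ne_zero (fun h => ?_) q_sub_inv_ne_zero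
  apply q_pow_ne_one (m := 2 * m) (by omega)
  have hq := pow_ne_zero m q_ne_zero
  rw [inv_pow, sub_eq_zero] at h
  rw [two_mul, pow_add]
  nth_rw 2 [h]
  exact mul_inv_cancel₀ hq

lemma qfact_ne_zero (m : ℕ) : qfact m ≠ 0 :=
  Finset.prod_ne_zero_iff.2 fun _ _ => qint_ne_zero (Nat.succ_ne_zero _)

lemma geom_sum_q_sq (m : ℕ) :
    ∑ i ∈ Finset.range m, (q ^ 2) ^ i = q ^ m * q⁻¹ * qint m := by
  have h1 := q_sub_inv_ne_zero
  have h2 := sub_ne_zero.2 (q_pow_ne_one two_ne_zero)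
  have hq := q_ne_zero
  rw [geom_sum_eq (q_pow_ne_one two_ne_zero), qint, mul_div_assoc', div_eq_div_iff h2 h1, inv_pow]
  field_simp
  ring

lemma qfact_eq_mul_prod {n k : ℕ} (hk : k ≤ n) :
    qfact n = qfact (n - k) * ∏ i ∈ Finset.range k, qint (n - i) := by
  induction k with
  | zero => simp
  | succ k ih =>
    rw [ih (by omega), Finset.prod_range_succ, show n - k = n - (k + 1) + 1 by omega, qfact,
      Finset.prod_range_succ, qfact]
    ring

lemma mem_weightSpace {n k : ℕ} {ψ : Tens n} :
    ψ ∈ weightSpace n k ↔ ∀ s, countOnes s ≠ k → ψ s = 0 := by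
  constructor
  · intro h s hs
    induction h using Submodule.span_induction with
    | mem x hx =>
      obtain ⟨t, ht, rfl⟩ := hx
      rw [Pi.single_apply, if_neg]
      rintro rfl
      exact hs ht
    | zero => rfl
    | add x y _ _ hx hy => simp [hx, hy]
    | smul a x _ hx => simp [hx]
  · intro h
    rw [show ψ = ∑ s, ψ s • (Pi.single s 1 : Tens n) by
      ext t; simp [Finset.sum_apply, Pi.single_apply]]
    refine Submodule.sum_mem _ fun s _ => ?_
    by_cases hs : countOnes s = k
    · exact Submodule.smul_mem _ _ (Submodule.subset_span ⟨s, hs, rfl⟩)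
    · simp [h s hs]

lemma countOnes_update_true {n : ℕ} {s : Fin n → Bool} {j : Fin n} (h : s j = false) :
    countOnes (Function.update s j true) = countOnes s + 1 := by
  have : (Finset.univ.filter fun r => Function.update s j true r = true) =
      insert j (Finset.univ.filter fun r => s r = true) := by
    ext r
    by_cases hr : r = j <;> simp [hr]
  rw [countOnes, this, Finset.card_insert_of_notMem (by simp [h]), countOnes]

lemma countOnes_update_false {n : ℕ} {s : Fin n → Bool} {j : Fin n} (h : s j = true) :
    countOnes (Function.update s j false) + 1 = countOnes s := by
  rw [← countOnes_update_true (j := j) (by simp), Function.update_idem, ← h,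
    Function.update_eq_self]

lemma eq_update_not_iff {ι : Type*} [DecidableEq ι] {s t : ι → Bool} {j : ι} (b : Bool) :
    (s j = !b ∧ t = Function.update s j b) ↔ (t j = b ∧ s = Function.update t j (!b)) := by
  constructor
  · rintro ⟨h, rfl⟩
    simp [← h]
  · rintro ⟨h, rfl⟩
    simp [← h]

lemma Eop_apply (n : ℕ) (ψ : Tens n) (t : Fin n → Bool) :
    Eop n ψ t = ∑ j, if t j = true then
      (∏ r ∈ Finset.univ.filter fun r => r < j, kval (t r)) * ψ (Function.update t j false)
      else 0 := by
  simp only [Eop, Matrix.mulVecLin_apply, Matrix.mulVec, dotProduct, Emat, Finset.sum_mul]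
  rw [Finset.sum_comm]
  refine Finset.sum_congr rfl fun j _ => ?_
  have hiff (s : Fin n → Bool) := eq_update_not_iff (s := s) (t := t) (j := j) true
  simp only [Bool.not_true] at hiff
  simp only [hiff, ite_and, ite_mul, zero_mul]
  split_ifs with h
  · rw [Finset.sum_ite_eq' Finset.univ]
    simp only [Finset.mem_univ, if_true]
    congr 1
    refine Finset.prod_congr rfl fun r hr => ?_
    rw [Function.update_of_ne (Finset.mem_filter.1 hr).2.ne]
  · simp

lemma Fop_apply (n : ℕ) (ψ : Tens n) (t : Fin n → Bool) :
    Fop n ψ t = ∑ j, if t j = false then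
      (∏ r ∈ Finset.univ.filter fun r => j < r, (kval (t r))⁻¹) * ψ (Function.update t j true)
      else 0 := by
  simp only [Fop, Matrix.mulVecLin_apply, Matrix.mulVec, dotProduct, Fmat, Finset.sum_mul]
  rw [Finset.sum_comm]
  refine Finset.sum_congr rfl fun j _ => ?_
  have hiff (s : Fin n → Bool) := eq_update_not_iff (s := s) (t := t) (j := j) false
  simp only [Bool.not_false] at hiff
  simp only [hiff, ite_and, ite_mul, zero_mul]
  split_ifs with h
  · rw [Finset.sum_ite_eq' Finset.univ]
    simp only [Finset.mem_univ, if_true]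
    congr 1
    refine Finset.prod_congr rfl fun r hr => ?_
    rw [Function.update_of_ne (Finset.mem_filter.1 hr).2.ne']
  · simp

lemma Fop_mem_weightSpace {n k : ℕ} {ψ : Tens n} (h : ψ ∈ weightSpace n (k + 1)) :
    Fop n ψ ∈ weightSpace n k := by
  rw [mem_weightSpace] at h ⊢
  intro t ht
  rw [Fop_apply]
  refine Finset.sum_eq_zero fun j _ => ?_
  split_ifs with hj
  · rw [h _ (by rw [countOnes_update_true hj]; omega), mul_zero]
  · rfl

lemma Fop_pow_mem_weightSpace {n k : ℕ} {ψ : Tens n} (h : ψ ∈ weightSpace n k) :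
    (Fop n ^ k) ψ ∈ weightSpace n 0 := by
  induction k generalizing ψ with
  | zero => simpa using h
  | succ k ih =>
    rw [pow_succ, Module.End.mul_apply]
    exact ih (Fop_mem_weightSpace h)

/-- The coefficient `q^{-Σ r}`, summed over the (0-based) positions `r` of the ones of `s`. -/
def posWeight {n : ℕ} (s : Fin n → Bool) : Fq := ∏ r, if s r = true then q⁻¹ ^ r.val else 1

/-- The `q`-symmetric vector of weight `k`, proportional to `E^k (v₀ ⊗ ⋯ ⊗ v₀)`. -/
def symVec (n k : ℕ) : Tens n := fun s => if countOnes s = k then posWeight s else 0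

lemma posWeight_update_true {n : ℕ} {s : Fin n → Bool} {j : Fin n} (h : s j = false) :
    posWeight (Function.update s j true) = q⁻¹ ^ j.val * posWeight s := by
  rw [posWeight, posWeight, ← Finset.mul_prod_erase _ _ (Finset.mem_univ j),
    ← Finset.mul_prod_erase Finset.univ (fun r => if s r = true then q⁻¹ ^ r.val else 1)
      (Finset.mem_univ j)]
  simp only [Function.update_self, if_true, h, Bool.false_eq_true, if_false, one_mul]
  congr 1
  refine Finset.prod_congr rfl fun r hr => ?_
  rw [Function.update_of_ne (Finset.ne_of_mem_erase hr)]

lemma posWeight_update_false {n : ℕ} {s : Fin n → Bool} {j : Fin n} (h : s j = true) :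
    q⁻¹ ^ j.val * posWeight (Function.update s j false) = posWeight s := by
  rw [← posWeight_update_true (by simp), Function.update_idem, ← h, Function.update_eq_self]

lemma symVec_mem_weightSpace (n k : ℕ) : symVec n k ∈ weightSpace n k :=
  mem_weightSpace.2 fun _ hs => if_neg hs

lemma countOnes_eq_zero {n : ℕ} {s : Fin n → Bool} :
    countOnes s = 0 ↔ s = fun _ => false := by
  simp [countOnes, Finset.filter_eq_empty_iff, funext_iff]

lemma eq_smul_symVec_zero {n : ℕ} {ψ : Tens n} (h : ψ ∈ weightSpace n 0) :
    ψ = ψ (fun _ => false) • symVec n 0 := by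
  rw [mem_weightSpace] at h
  ext s
  by_cases hs : countOnes s = 0
  · obtain rfl := countOnes_eq_zero.1 hs
    simp [symVec, hs, posWeight]
  · simp [h s hs, symVec, hs]

lemma kval_eq (b : Bool) : kval b = q⁻¹ * if b = true then q ^ 2 else 1 := by
  have := q_ne_zero
  cases b
  · simp [kval]
  · simp only [kval, if_true]
    field_simp

lemma kval_inv_eq (b : Bool) : (kval b)⁻¹ = q⁻¹ * if (!b) = true then q ^ 2 else 1 := by
  have := q_ne_zero
  cases b
  · simp only [kval, Bool.false_eq_true, if_false, Bool.not_false, if_true, inv_inv]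
    field_simp
  · simp [kval]

lemma countOnes_not {n : ℕ} (s : Fin n → Bool) : countOnes (fun r => !s r) = n - countOnes s := by
  have h := Finset.card_filter_add_card_filter_not (s := (Finset.univ : Finset (Fin n)))
    (fun r => s r = true)
  simp only [Finset.card_univ, Fintype.card_fin] at h
  simp only [countOnes, Bool.not_eq_true', ← Bool.not_eq_true]
  omega

lemma Eop_symVec (n k : ℕ) :
    Eop n (symVec n k) = (q ^ k * qint (k + 1)) • symVec n (k + 1) := by
  have hq := q_ne_zero
  have hgeom : q ^ k * qint (k + 1) = ∑ i ∈ Finset.range (k + 1), (q ^ 2) ^ i := by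
    rw [geom_sum_q_sq]
    field_simp
    ring
  ext t
  rw [Eop_apply, hgeom, Pi.smul_apply, smul_eq_mul]
  by_cases ht : countOnes t = k + 1
  · rw [← ht, ← sum_prod_lt_eq_geom_sum, Finset.sum_mul]
    refine Finset.sum_congr rfl fun j _ => ?_
    split_ifs with hj
    · have hc : countOnes (Function.update t j false) = k := by
        have := countOnes_update_false hj
        omega
      simp only [symVec, hc, if_true, ← posWeight_update_false hj, kval_eq]
      rw [Finset.prod_mul_distrib, Finset.prod_const, Finset.filter_gt_eq_Iio,
        Fin.card_Iio]
      ring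
    · rw [zero_mul]
  · rw [symVec, if_neg ht, mul_zero]
    refine Finset.sum_eq_zero fun j _ => ?_
    split_ifs with hj
    · have := countOnes_update_false hj
      rw [symVec, if_neg (by omega), mul_zero]
    · rfl

lemma Fop_symVec {n k : ℕ} (hk : k < n) :
    Fop n (symVec n (k + 1)) = (q⁻¹ ^ k * qint (n - k)) • symVec n k := by
  have hq := q_ne_zero
  have hgeom : q⁻¹ ^ k * qint (n - k) =
      q⁻¹ ^ (n - 1) * ∑ i ∈ Finset.range (n - k), (q ^ 2) ^ i := by
    obtain ⟨m, rfl⟩ := Nat.exists_eq_add_of_lt hk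
    rw [geom_sum_q_sq, show k + m + 1 - k = m + 1 by omega, Nat.add_sub_cancel, pow_add, inv_pow, inv_pow]
    field_simp
    ring
  ext t
  rw [Fop_apply, hgeom, Pi.smul_apply, smul_eq_mul]
  by_cases ht : countOnes t = k
  · rw [← ht, ← countOnes_not, ← sum_prod_gt_eq_geom_sum, Finset.mul_sum, Finset.sum_mul]
    refine Finset.sum_congr rfl fun j _ => ?_
    simp only [Bool.not_eq_true']
    split_ifs with hj
    · simp only [symVec, countOnes_update_true hj, ht, if_true, posWeight_update_true hj,
        kval_inv_eq, Bool.not_eq_true']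
      rw [Finset.prod_mul_distrib, Finset.prod_const, Finset.filter_lt_eq_Ioi,
        Fin.card_Ioi,
        show n - 1 = (n - 1 - j.val) + j.val by omega, pow_add,
        Nat.add_sub_cancel]
      ring
    · simp
  · rw [symVec, if_neg ht, mul_zero]
    refine Finset.sum_eq_zero fun j _ => ?_
    split_ifs with hj
    · rw [symVec, if_neg (by rw [countOnes_update_true hj]; omega), mul_zero]
    · rfl

lemma Eop_pow_symVec (n k : ℕ) :
    (Eop n ^ k) (symVec n 0) = (∏ i ∈ Finset.range k, q ^ i * qint (i + 1)) • symVec n k := by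
  induction k with
  | zero => simp
  | succ k ih =>
    rw [pow_succ', Module.End.mul_apply, ih, map_smul, Eop_symVec, smul_smul,
      Finset.prod_range_succ]

lemma Fop_pow_symVec {n k : ℕ} (hk : k ≤ n) :
    (Fop n ^ k) (symVec n k) = (∏ i ∈ Finset.range k, q⁻¹ ^ i * qint (n - i)) • symVec n 0 := by
  induction k with
  | zero => simp
  | succ k ih =>
    rw [pow_succ, Module.End.mul_apply, Fop_symVec hk, map_smul, ih (by omega), smul_smul,
      Finset.prod_range_succ, mul_comm]

lemma Fop_pow_Eop_pow_symVec {n k : ℕ} (hk : k ≤ n) :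
    (Fop n ^ k) ((Eop n ^ k) (symVec n 0)) = (qbinom n k * qfact k ^ 2) • symVec n 0 := by
  rw [Eop_pow_symVec, map_smul, Fop_pow_symVec hk, smul_smul]
  congr 1
  have h1 := qfact_ne_zero k
  have h2 := qfact_ne_zero (n - k)
  rw [qbinom, qfact_eq_mul_prod hk, Finset.prod_mul_distrib, Finset.prod_mul_distrib]
  have hcancel : (∏ i ∈ Finset.range k, q ^ i) * ∏ i ∈ Finset.range k, q⁻¹ ^ i = 1 := by
    rw [← Finset.prod_mul_distrib]
    exact Finset.prod_eq_one fun i _ => by rw [← mul_pow, mul_inv_cancel₀ q_ne_zero, one_pow]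
  have hfact : ∏ i ∈ Finset.range k, qint (i + 1) = qfact k := rfl
  rw [hfact]
  rw [mul_mul_mul_comm, hcancel]
  field_simp

lemma JW_apply (n k : ℕ) (ψ : Tens n) :
    JW n k ψ = (qbinom n k * qfact k ^ 2)⁻¹ • (Eop n ^ k) ((Fop n ^ k) ψ) := by
  simp only [JW, Ediv, Fdiv, LinearMap.smul_apply, LinearMap.comp_apply, map_smul, smul_smul]
  congr 1
  rw [mul_inv, sq, mul_inv]

/-- the operator `P_k = (1/[n choose k])·E^{(k)} ∘ F^{(k)}` maps the
weight space `W_k` into itself and its restriction to `W_k` is idempotent. -/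
theorem jones_wenzl_idempotent (n : ℕ) (hn : 1 ≤ n) (k : ℕ) (hk : k ≤ n) :
    (∀ ψ ∈ weightSpace n k, JW n k ψ ∈ weightSpace n k) ∧
    (∀ ψ ∈ weightSpace n k, JW n k (JW n k ψ) = JW n k ψ) := by
  have hne : qbinom n k * qfact k ^ 2 ≠ 0 :=
    mul_ne_zero (div_ne_zero (qfact_ne_zero n) (mul_ne_zero (qfact_ne_zero k) (qfact_ne_zero _)))
      (pow_ne_zero 2 (qfact_ne_zero k))
  refine ⟨fun ψ hψ => ?_, fun ψ hψ => ?_⟩ <;>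
    rw [JW_apply n k ψ, eq_smul_symVec_zero (Fop_pow_mem_weightSpace hψ), map_smul]
  · rw [Eop_pow_symVec]
    exact Submodule.smul_mem _ _ (Submodule.smul_mem _ _
      (Submodule.smul_mem _ _ (symVec_mem_weightSpace n k)))
  · rw [map_smul, map_smul, JW_apply, Fop_pow_Eop_pow_symVec hk, map_smul, inv_smul_smul₀ hne]
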